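/- Let ρ₋, ρ₊ > 0, u₋ > u₊, β ∈ ℝ and t ≥ 0. Suppose ρ* : (1,2) → ℝ is a continuous function such that for every γ ∈ (1,2), ρ*(γ) > max(ρ₋,ρ₊) and u₋ − u₊ = Θ_γ(ρ*(γ),ρ₋)·(ρ*(γ) − ρ₋) + Θ_γ(ρ*(γ),ρ₊)·(ρ*(γ) − ρ₊). Define v*(γ) = u₋ − Θ_γ(ρ*(γ),ρ₋)·(ρ*(γ) − ρ₋), σ₁^γ(t) = u₋ + βt − ρ*(γ)·Θ_γ(ρ*(γ),ρ₋), and σ₂^γ(t) = v*(γ) + βt + ρ₊·Θ_γ(ρ*(γ),ρ₊). Then ρ*(γ)·(σ₂^γ(t) − σ₁^γ(t)) → (1/2)(ρ₋ + ρ₊)(u₋ − u₊) as γ → 1⁺. -/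

import Mathlib

open Real Filter Topology

/-- The shock-curve slope coefficient Θ_γ(a,b) from equation (4.9). -/
noncomputable def Theta (γ a b : ℝ) : ℝ :=
  Real.sqrt (((γ - 1) / 2) * (a ^ (γ - 1) - b ^ (γ - 1)) / ((a + b) * (a - b)))

lemma Theta_mul_sub_le {γ a b : ℝ} (hγ : 1 < γ) (hb : 0 < b) (hab : b < a) :
    Theta γ a b * (a - b) ≤ √((γ - 1) / 2 * a ^ (γ - 1)) := by
  have ha : 0 < a := hb.trans hab
  have hd : 0 < a - b := sub_pos.2 hab
  have hpb : 0 < b ^ (γ - 1) := rpow_pos_of_pos hb _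
  have hpa : 0 < a ^ (γ - 1) := rpow_pos_of_pos ha _
  have hε : 0 < γ - 1 := sub_pos.2 hγ
  rw [← Real.sqrt_sq hd.le, Theta, ← Real.sqrt_mul' _ (sq_nonneg _)]
  apply Real.sqrt_le_sqrt
  have h1 : (γ - 1) / 2 * (a ^ (γ - 1) - b ^ (γ - 1)) / ((a + b) * (a - b)) * (a - b) ^ 2
      = (γ - 1) / 2 * (a ^ (γ - 1) - b ^ (γ - 1)) * (a - b) / (a + b) := by
    field_simp
  rw [h1, div_le_iff₀ (by positivity)]
  have h2 : (a ^ (γ - 1) - b ^ (γ - 1)) * (a - b) ≤ a ^ (γ - 1) * (a + b) := by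
    nlinarith [mul_pos hpb hd, mul_pos hpa hb]
  nlinarith [mul_le_mul_of_nonneg_left h2 (half_pos hε).le]

/-- The factor by which `a * Theta γ a b` differs from `√((γ - 1) / 2 * a ^ (γ - 1))`. -/
noncomputable def thetaFactor (γ a b : ℝ) : ℝ :=
  √((1 - b ^ (γ - 1) / a ^ (γ - 1)) / ((1 + b / a) * (1 - b / a)))

lemma mul_Theta_eq {γ a b : ℝ} (hγ : 1 < γ) (ha : 0 < a) :
    a * Theta γ a b = √((γ - 1) / 2 * a ^ (γ - 1)) * thetaFactor γ a b := by
  have hpa : 0 < a ^ (γ - 1) := rpow_pos_of_pos ha _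
  have hε : 0 < γ - 1 := sub_pos.2 hγ
  rw [thetaFactor, ← Real.sqrt_mul (by positivity), Theta]
  nth_rewrite 1 [← Real.sqrt_sq ha.le]
  rw [← Real.sqrt_mul (sq_nonneg _)]
  congr 1
  have h1 : (1 + b / a) * (1 - b / a) = (a + b) * (a - b) / a ^ 2 := by field_simp
  have h2 : 1 - b ^ (γ - 1) / a ^ (γ - 1) = (a ^ (γ - 1) - b ^ (γ - 1)) / a ^ (γ - 1) := by
    field_simp
  rw [h1, h2, div_div_eq_mul_div, div_mul_eq_mul_div, ← mul_div_assoc, ← mul_div_assoc,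
    ← mul_div_assoc]
  congr 1
  field_simp

lemma tendsto_thetaFactor {ρs : ℝ → ℝ} {b : ℝ} (hb : 0 < b)
    (hρ : Tendsto ρs (𝓝[>] 1) atTop)
    (hpow : Tendsto (fun γ => ρs γ ^ (γ - 1)) (𝓝[>] 1) atTop) :
    Tendsto (fun γ => thetaFactor γ (ρs γ) b) (𝓝[>] 1) (𝓝 1) := by
  have hbpow : Tendsto (fun γ : ℝ => b ^ (γ - 1)) (𝓝[>] 1) (𝓝 1) := by
    have hc : Continuous fun γ : ℝ => b ^ (γ - 1) :=
      continuous_const.rpow (by fun_prop) fun _ => Or.inl hb.ne'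
    simpa using (hc.tendsto 1).mono_left nhdsWithin_le_nhds
  have h1 := hbpow.div_atTop hpow
  have h2 : Tendsto (fun γ => b / ρs γ) (𝓝[>] 1) (𝓝 0) := tendsto_const_nhds.div_atTop hρ
  have h3 := (h1.const_sub 1).div ((h2.const_add 1).mul (h2.const_sub 1)) (by norm_num)
  simpa [thetaFactor] using h3.sqrt

/-- Lemma 4.3, formula (4.12)/(4.15): the mass concentrated between the two shocks
converges to the weight of the limiting delta shock. -/
theorem lemma43_weight (ρm ρp um up β t : ℝ) (hρm : 0 < ρm) (hρp : 0 < ρp)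
    (hu : up < um) (ht : 0 ≤ t)
    (ρs : ℝ → ℝ) (hcont : ContinuousOn ρs (Set.Ioo (1 : ℝ) 2))
    (hgt : ∀ γ ∈ Set.Ioo (1 : ℝ) 2, ρs γ > max ρm ρp)
    (heq : ∀ γ ∈ Set.Ioo (1 : ℝ) 2,
      um - up = Theta γ (ρs γ) ρm * (ρs γ - ρm) + Theta γ (ρs γ) ρp * (ρs γ - ρp)) :
    Tendsto
      (fun γ : ℝ =>
        ρs γ *
          (((um - Theta γ (ρs γ) ρm * (ρs γ - ρm)) + β * t + ρp * Theta γ (ρs γ) ρp) -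
            (um + β * t - ρs γ * Theta γ (ρs γ) ρm)))
      (𝓝[>] (1 : ℝ)) (𝓝 ((1 / 2) * (ρm + ρp) * (um - up))) := by
  have hmem : ∀ᶠ γ : ℝ in 𝓝[>] 1, γ ∈ Set.Ioo (1 : ℝ) 2 := Ioo_mem_nhdsGT (by norm_num)
  have hm γ (h : γ ∈ Set.Ioo (1 : ℝ) 2) : ρm < ρs γ := (le_max_left _ _).trans_lt (hgt γ h)
  have hp γ (h : γ ∈ Set.Ioo (1 : ℝ) 2) : ρp < ρs γ := (le_max_right _ _).trans_lt (hgt γ h)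
  have hc : 0 < um - up := sub_pos.2 hu
  have hinv : Tendsto (fun γ : ℝ => (γ - 1)⁻¹) (𝓝[>] 1) atTop := by
    refine tendsto_inv_nhdsGT_zero.comp (tendsto_nhdsWithin_iff.2 ⟨?_, ?_⟩)
    · have h : Continuous fun γ : ℝ => γ - 1 := by fun_prop
      simpa using (h.tendsto 1).mono_left nhdsWithin_le_nhds
    · filter_upwards [hmem] with γ hγ using sub_pos.2 hγ.1
  have hpow : Tendsto (fun γ => ρs γ ^ (γ - 1)) (𝓝[>] 1) atTop := by
    refine tendsto_atTop_mono' _ ?_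
      (hinv.const_mul_atTop (show 0 < (um - up) ^ 2 / 2 by positivity))
    filter_upwards [hmem] with γ hγ
    have hε : 0 < γ - 1 := sub_pos.2 hγ.1
    have hx : 0 < ρs γ ^ (γ - 1) := rpow_pos_of_pos (hρm.trans (hm γ hγ)) _
    have h1 := Theta_mul_sub_le hγ.1 hρm (hm γ hγ)
    have h2 := Theta_mul_sub_le hγ.1 hρp (hp γ hγ)
    have hs := Real.sq_sqrt (show 0 ≤ (γ - 1) / 2 * ρs γ ^ (γ - 1) by positivity)
    have h3 : um - up ≤ 2 * √((γ - 1) / 2 * ρs γ ^ (γ - 1)) := by linarith [heq γ hγ]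
    rw [← div_eq_mul_inv, div_le_iff₀ hε]
    nlinarith [pow_le_pow_left₀ hc.le h3 2]
  have hρ : Tendsto ρs (𝓝[>] 1) atTop := by
    refine tendsto_atTop_mono' _ ?_ hpow
    filter_upwards [hmem, hpow.eventually_gt_atTop 1] with γ hγ h
    have hx : 0 < ρs γ := hρm.trans (hm γ hγ)
    have h1 : 1 ≤ ρs γ := by
      by_contra! hlt
      exact h.not_ge (rpow_le_one hx.le hlt.le (sub_pos.2 hγ.1).le)
    simpa using rpow_le_rpow_of_exponent_le h1 (show γ - 1 ≤ 1 by linarith [hγ.2])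
  have hfm := tendsto_thetaFactor hρm hρ hpow
  have hfp := tendsto_thetaFactor hρp hρ hpow
  have hqm : Tendsto (fun γ => ρm / ρs γ) (𝓝[>] 1) (𝓝 0) := tendsto_const_nhds.div_atTop hρ
  have hqp : Tendsto (fun γ => ρp / ρs γ) (𝓝[>] 1) (𝓝 0) := tendsto_const_nhds.div_atTop hρ
  have hsum := (hfm.mul (hqm.const_sub 1)).add (hfp.mul (hqp.const_sub 1))
  have hlim := ((tendsto_const_nhds (x := um - up)).div hsum (by norm_num)).mul
    ((hfm.const_mul ρm).add (hfp.const_mul ρp))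
  have hval : (um - up) / (1 * (1 - 0) + 1 * (1 - 0)) * (ρm * 1 + ρp * 1)
      = 1 / 2 * (ρm + ρp) * (um - up) := by ring
  rw [hval] at hlim
  refine hlim.congr' ?_
  filter_upwards [hmem, hsum.eventually_ne (show (1 * (1 - 0) + 1 * (1 - 0) : ℝ) ≠ 0 by norm_num)]
    with γ hγ hne
  have hx : 0 < ρs γ := hρm.trans (hm γ hγ)
  have hA := mul_Theta_eq (b := ρm) hγ.1 hx
  have hB := mul_Theta_eq (b := ρp) hγ.1 hx
  have hs : (um - up) / (thetaFactor γ (ρs γ) ρm * (1 - ρm / ρs γ) +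
      thetaFactor γ (ρs γ) ρp * (1 - ρp / ρs γ)) = √((γ - 1) / 2 * ρs γ ^ (γ - 1)) := by
    rw [div_eq_iff hne, mul_add, ← mul_assoc, ← mul_assoc, ← hA, ← hB, heq γ hγ]
    field_simp
  rw [Pi.div_apply, hs]
  linear_combination -ρm * hA - ρp * hB
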